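/- arXiv:1910.00693 — 9 statements merged into one kernel-verified Lean document; each statement's English description precedes it below -/
import Mathlib

section
/- Let m ≥ 1, let g : ℝ^m → ℝ^m be continuously differentiable, let r ∈ ℝ^m be a constant, let α > 0, and let u : [0,∞) → ℝ^m be differentiable and satisfy, for every t ≥ 0, that the Jacobian Dg(u(t)) is invertible and u̇(t) = α · Dg(u(t))⁻¹ (r − g(u(t))) (the speed-up Newton–Raphson flow). Then for every t ≥ 0, ‖r − g(u(t))‖ = e^{−αt} ‖r − g(u(0))‖; in particular lim_{t→∞} (r − g(u(t))) = 0. -/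
open Filter Topology

/-- A solution of the linear decay equation with rate `α` on `[0, ∞)` is `exp (-α * t) • e 0`. -/
theorem eq_exp_smul_of_hasDerivAt_neg_smul {E : Type*} [NormedAddCommGroup E] [NormedSpace ℝ E]
    {α : ℝ} {e : ℝ → E} (he : ∀ t : ℝ, 0 ≤ t → HasDerivAt e (-α • e t) t) {t : ℝ} (ht : 0 ≤ t) :
    e t = Real.exp (-α * t) • e 0 := by
  have hd : ∀ s : ℝ, 0 ≤ s → HasDerivAt (fun s => Real.exp (α * s) • e s) 0 s := by
    intro s hs
    have hexp : HasDerivAt (fun s => Real.exp (α * s)) (Real.exp (α * s) * α) s := by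
      simpa using ((hasDerivAt_id s).const_mul α).exp
    refine (hexp.smul (he s hs)).congr_deriv ?_
    rw [smul_smul, ← add_smul]
    simp
  have hconst := constant_of_has_deriv_right_zero
    (fun s hs => (hd s hs.1).continuousAt.continuousWithinAt)
    (fun s hs => (hd s hs.1).hasDerivWithinAt) t ⟨ht, le_rfl⟩
  simp only [mul_zero, Real.exp_zero, one_smul] at hconst
  rw [← hconst, smul_smul, ← Real.exp_add]
  simp

/-- Newton–Raphson flow for a memoryless plant and a constant reference:
exponential decay of the tracking error and asymptotic tracking. -/
theorem newton_raphson_flow_constant_reference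
    (m : ℕ) (hm : 1 ≤ m)
    (g : EuclideanSpace ℝ (Fin m) → EuclideanSpace ℝ (Fin m))
    (hg : ContDiff ℝ 1 g)
    (r : EuclideanSpace ℝ (Fin m))
    (α : ℝ) (hα : 0 < α)
    (u : ℝ → EuclideanSpace ℝ (Fin m))
    (hu : ∀ t : ℝ, 0 ≤ t →
      ∃ J : EuclideanSpace ℝ (Fin m) ≃L[ℝ] EuclideanSpace ℝ (Fin m),
        (J : EuclideanSpace ℝ (Fin m) →L[ℝ] EuclideanSpace ℝ (Fin m)) = fderiv ℝ g (u t) ∧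
        HasDerivAt u (α • J.symm (r - g (u t))) t) :
    (∀ t : ℝ, 0 ≤ t → ‖r - g (u t)‖ = Real.exp (-α * t) * ‖r - g (u 0)‖) ∧
    Tendsto (fun t => r - g (u t)) atTop (nhds 0) := by
  have he : ∀ t : ℝ, 0 ≤ t →
      HasDerivAt (fun t => r - g (u t)) (-α • (r - g (u t))) t := by
    intro t ht
    obtain ⟨J, hJ, hut⟩ := hu t ht
    have hgt : HasFDerivAt g (J : EuclideanSpace ℝ (Fin m) →L[ℝ] EuclideanSpace ℝ (Fin m)) (u t) :=
      hJ ▸ (hg.differentiable one_ne_zero (u t)).hasFDerivAt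
    refine ((hgt.comp_hasDerivAt t hut).const_sub r).congr_deriv ?_
    rw [map_smul, ContinuousLinearEquiv.coe_coe, J.apply_symm_apply, neg_smul]
  have hsol : ∀ t : ℝ, 0 ≤ t → r - g (u t) = Real.exp (-α * t) • (r - g (u 0)) :=
    fun t ht => eq_exp_smul_of_hasDerivAt_neg_smul he ht
  refine ⟨fun t ht => ?_, ?_⟩
  · rw [hsol t ht, norm_smul, Real.norm_of_nonneg (Real.exp_nonneg _)]
  · have hexp : Tendsto (fun t : ℝ => Real.exp (-α * t)) atTop (𝓝 0) :=
      Real.tendsto_exp_atBot.comp (tendsto_id.const_mul_atTop_of_neg (neg_neg_of_pos hα))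
    have hlim := hexp.smul_const (r - g (u 0))
    rw [zero_smul] at hlim
    refine hlim.congr' ?_
    filter_upwards [eventually_ge_atTop 0] with t ht using (hsol t ht).symm
end

section
/- Let m ≥ 1, let g : ℝ^m → ℝ^m be continuously differentiable, let r : ℝ → ℝ^m be continuously differentiable with η := limsup_{t→∞} ‖ṙ(t)‖ < ∞, let α > 0, and let u : [0,∞) → ℝ^m be differentiable and satisfy, for every t ≥ 0, that Dg(u(t)) is invertible and u̇(t) = α · Dg(u(t))⁻¹ (r(t) − g(u(t))). Then limsup_{t→∞} ‖r(t) − g(u(t))‖ ≤ η/α. -/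
open Filter Topology ENNReal

/-- Differential inequality for a stable linear filter: if `e' = v - α e` with `‖v‖ ≤ c` on
`[T, ∞)`, then `‖e‖` is at most `c / α` up to an exponentially decaying term. -/
theorem norm_le_exp_mul_add_div_of_hasDerivAt {E : Type*} [NormedAddCommGroup E]
    [NormedSpace ℝ E] {e v : ℝ → E} {α c T : ℝ} (hα : 0 < α)
    (he : ∀ t, T ≤ t → HasDerivAt e (v t - α • e t) t)
    (hv : ∀ t, T ≤ t → ‖v t‖ ≤ c) {t : ℝ} (ht : T ≤ t) :
    ‖e t‖ ≤ Real.exp (-(α * t)) * (Real.exp (α * T) * ‖e T‖) + c / α := by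
  have hc : 0 ≤ c := (norm_nonneg _).trans (hv T le_rfl)
  have hexp (x : ℝ) : HasDerivAt (fun y => Real.exp (α * y)) (Real.exp (α * x) * α) x := by
    simpa using ((hasDerivAt_id x).const_mul α).exp
  have hf (x : ℝ) (hx : T ≤ x) :
      HasDerivAt (fun y => Real.exp (α * y) • e y) (Real.exp (α * x) • v x) x := by
    refine ((hexp x).smul (he x hx)).congr_deriv ?_
    module
  have hB (x : ℝ) : HasDerivAt
      (fun y => Real.exp (α * T) * ‖e T‖ + c / α * Real.exp (α * y))
      (c * Real.exp (α * x)) x := by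
    refine (((hexp x).const_mul (c / α)).const_add (Real.exp (α * T) * ‖e T‖)).congr_deriv ?_
    field_simp
  have key := image_norm_le_of_norm_deriv_right_le_deriv_boundary (a := T) (b := t)
    (fun x hx => (hf x hx.1).continuousAt.continuousWithinAt)
    (fun x hx => (hf x hx.1).hasDerivWithinAt)
    (by
      rw [norm_smul, Real.norm_of_nonneg (Real.exp_pos _).le]
      exact le_add_of_nonneg_right (by positivity))
    hB
    (fun x hx => by
      rw [norm_smul, Real.norm_of_nonneg (Real.exp_pos _).le, mul_comm]
      exact mul_le_mul_of_nonneg_right (hv x hx.1) (Real.exp_pos _).le)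
    (Set.right_mem_Icc.2 ht)
  rw [norm_smul, Real.norm_of_nonneg (Real.exp_pos _).le] at key
  have hpos := Real.exp_pos (α * t)
  rw [Real.exp_neg]
  refine le_of_mul_le_mul_left (key.trans_eq ?_) hpos
  field_simp

/-- If `e' = v - α e` eventually, then `limsup ‖e‖ ≤ limsup ‖v‖ / α`. -/
theorem limsup_nnnorm_le_div_of_hasDerivAt {E : Type*} [NormedAddCommGroup E]
    [NormedSpace ℝ E] {e v : ℝ → E} {α : ℝ} (hα : 0 < α)
    (he : ∀ᶠ t in atTop, HasDerivAt e (v t - α • e t) t) :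
    limsup (fun t => (‖e t‖₊ : ℝ≥0∞)) atTop ≤
      limsup (fun t => (‖v t‖₊ : ℝ≥0∞)) atTop / ENNReal.ofReal α := by
  have hα' : ENNReal.ofReal α ≠ 0 := (ENNReal.ofReal_pos.2 hα).ne'
  rw [ENNReal.le_div_iff_mul_le (Or.inl hα') (Or.inl ENNReal.ofReal_ne_top)]
  refine le_of_forall_gt_imp_ge_of_dense fun b hb => ?_
  obtain ⟨c, hLc, hcb⟩ := ENNReal.lt_iff_exists_nnreal_btwn.1 hb
  refine le_trans ?_ hcb.le
  rw [← ENNReal.le_div_iff_mul_le (Or.inl hα') (Or.inl ENNReal.ofReal_ne_top),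
    ← ENNReal.ofReal_coe_nnreal, ← ENNReal.ofReal_div_of_pos hα]
  obtain ⟨T, hT⟩ := eventually_atTop.1 (he.and (eventually_lt_of_limsup_lt hLc))
  have hv (t : ℝ) (ht : T ≤ t) : ‖v t‖ ≤ c := by
    exact_mod_cast (ENNReal.coe_lt_coe.1 (hT t ht).2).le
  have hlim : Tendsto
      (fun t => Real.exp (-(α * t)) * (Real.exp (α * T) * ‖e T‖) + c / α) atTop
      (𝓝 (c / α)) := by
    have := ((Real.tendsto_exp_neg_atTop_nhds_zero.comp
      (tendsto_id.const_mul_atTop hα)).mul_const (Real.exp (α * T) * ‖e T‖)).add_const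
        ((c : ℝ) / α)
    simpa using this
  rw [← (ENNReal.tendsto_ofReal hlim).limsup_eq]
  refine limsup_le_limsup ?_
  filter_upwards [eventually_ge_atTop T] with t ht
  rw [← enorm_eq_nnnorm, ← ofReal_norm]
  exact ENNReal.ofReal_le_ofReal
    (norm_le_exp_mul_add_div_of_hasDerivAt hα (fun t ht => (hT t ht).1) hv ht)

/-- Newton–Raphson flow with speed-up gain `α` for a memoryless plant and a
time-varying reference: the asymptotic tracking error is at most `η/α`, where
`η` is the asymptotic magnitude of `ṙ`. -/
theorem newton_raphson_flow_time_varying_reference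
    (m : ℕ) (hm : 1 ≤ m)
    (g : EuclideanSpace ℝ (Fin m) → EuclideanSpace ℝ (Fin m))
    (hg : ContDiff ℝ 1 g)
    (r : ℝ → EuclideanSpace ℝ (Fin m))
    (hr : ContDiff ℝ 1 r)
    (hη : Filter.limsup (fun t => (‖deriv r t‖₊ : ℝ≥0∞)) Filter.atTop < ⊤)
    (α : ℝ) (hα : 0 < α)
    (u : ℝ → EuclideanSpace ℝ (Fin m))
    (hu : ∀ t : ℝ, 0 ≤ t →
      ∃ J : EuclideanSpace ℝ (Fin m) ≃L[ℝ] EuclideanSpace ℝ (Fin m),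
        (J : EuclideanSpace ℝ (Fin m) →L[ℝ] EuclideanSpace ℝ (Fin m)) = fderiv ℝ g (u t) ∧
        HasDerivAt u (α • J.symm (r t - g (u t))) t) :
    Filter.limsup (fun t => (‖r t - g (u t)‖₊ : ℝ≥0∞)) Filter.atTop ≤
      (Filter.limsup (fun t => (‖deriv r t‖₊ : ℝ≥0∞)) Filter.atTop) / ENNReal.ofReal α := by
  refine limsup_nnnorm_le_div_of_hasDerivAt hα ?_
  filter_upwards [eventually_ge_atTop (0 : ℝ)] with t ht
  obtain ⟨J, hJ, hut⟩ := hu t ht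
  have hgu := ((hg.differentiable one_ne_zero (u t)).hasFDerivAt).comp_hasDerivAt t hut
  rw [← hJ] at hgu
  have hrt := ((hr.differentiable one_ne_zero) t).hasDerivAt
  refine (hrt.sub hgu).congr_deriv ?_
  simp
end

section
/- (Proposition 3.1) Let n, m ≥ 1, let f : ℝ^n × ℝ^m → ℝ^n be continuous, let g : ℝ^n × ℝ^m → ℝ^m be continuously differentiable, let r : ℝ → ℝ^m be differentiable, let T > 0, and let x : [0,∞) → ℝ^n and u : [0,∞) → ℝ^m be differentiable functions satisfying, for every t ≥ 0: ẋ(t) = f(x(t), u(t)); the partial Jacobian D_u g(x(t), u(t)) is invertible; and u̇(t) = (D_u g(x(t),u(t)))⁻¹ ( r(t+T) − g(x(t),u(t)) + ṙ(t+T) − D_x g(x(t),u(t)) f(x(t),u(t)) ). Define V(t) := ½ ‖r(t+T) − g(x(t),u(t))‖². Then V̇(t) = −2 V(t) for all t ≥ 0, and consequently lim_{t→∞} ( r(t+T) − g(x(t),u(t)) ) = 0. -/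
open Filter Topology

section

variable {E F G : Type*} [NormedAddCommGroup E] [NormedSpace ℝ E]
  [NormedAddCommGroup F] [NormedSpace ℝ F] [NormedAddCommGroup G] [NormedSpace ℝ G]

/-- Chain rule along a curve in a product, in terms of the two partial derivatives. -/
theorem HasDerivAt.comp_prodMk_partial {g : E × F → G} {x : ℝ → E} {u : ℝ → F}
    {x' : E} {u' : F} {t : ℝ} (hg : DifferentiableAt ℝ g (x t, u t))
    (hx : HasDerivAt x x' t) (hu : HasDerivAt u u' t) :
    HasDerivAt (fun τ => g (x τ, u τ))
      (fderiv ℝ (fun a => g (a, u t)) (x t) x' + fderiv ℝ (fun b => g (x t, b)) (u t) u') t := by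
  have hfst : HasFDerivAt (fun a => g (a, u t)) _ (x t) :=
    hg.hasFDerivAt.comp (x t) (hasFDerivAt_prodMk_left (x t) (u t))
  have hsnd : HasFDerivAt (fun b => g (x t, b)) _ (u t) :=
    hg.hasFDerivAt.comp (u t) (hasFDerivAt_prodMk_right (x t) (u t))
  have h : HasDerivAt (fun τ => g (x τ, u τ)) (fderiv ℝ g (x t, u t) (x', u')) t :=
    hg.hasFDerivAt.comp_hasDerivAt t (hx.prodMk hu)
  rw [hfst.fderiv, hsnd.fderiv]
  simpa [← map_add] using h

/-- A solution of `ė = -e` on `[0, ∞)` is `t ↦ exp (-t) • e 0`. -/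
theorem eq_exp_neg_smul_of_hasDerivAt_neg {e : ℝ → E}
    (he : ∀ t, 0 ≤ t → HasDerivAt e (-e t) t) {t : ℝ} (ht : 0 ≤ t) :
    e t = Real.exp (-t) • e 0 := by
  have h : ∀ s, 0 ≤ s → HasDerivAt (fun τ => Real.exp τ • e τ) 0 s := fun s hs => by
    exact ((Real.hasDerivAt_exp s).smul (he s hs)).congr_deriv (by simp)
  have hc : Real.exp t • e t = Real.exp 0 • e 0 :=
    constant_of_has_deriv_right_zero
      (fun s hs => (h s hs.1).continuousAt.continuousWithinAt)
      (fun s hs => (h s hs.1).hasDerivWithinAt) t ⟨ht, le_rfl⟩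
  rw [Real.exp_zero, one_smul] at hc
  rw [← hc, smul_smul, ← Real.exp_add, neg_add_cancel, Real.exp_zero, one_smul]

/-- A solution of `ė = -e` on `[0, ∞)` tends to zero. -/
theorem tendsto_zero_of_hasDerivAt_neg {e : ℝ → E}
    (he : ∀ t, 0 ≤ t → HasDerivAt e (-e t) t) : Tendsto e atTop (𝓝 0) := by
  have h : Tendsto (fun t : ℝ => Real.exp (-t) • e 0) atTop (𝓝 0) := by
    simpa using Real.tendsto_exp_neg_atTop_nhds_zero.smul_const (e 0)
  refine h.congr' ?_
  filter_upwards [eventually_ge_atTop 0] with t ht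
  exact (eq_exp_neg_smul_of_hasDerivAt_neg he ht).symm

end

/-- Proposition 3.1: along a nonsingular trajectory of the modified
Newton–Raphson tracking controller, the Lyapunov function
`V(t) = ½‖r(t+T) − g(x(t),u(t))‖²` satisfies `V̇ = −2V`, and consequently
`r(t+T) − ŷ(t+T) → 0`. -/
theorem modified_controller_exact_tracking
    (n m : ℕ) (hn : 1 ≤ n) (hm : 1 ≤ m)
    (f : EuclideanSpace ℝ (Fin n) × EuclideanSpace ℝ (Fin m) → EuclideanSpace ℝ (Fin n))
    (hf : Continuous f)
    (g : EuclideanSpace ℝ (Fin n) × EuclideanSpace ℝ (Fin m) → EuclideanSpace ℝ (Fin m))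
    (hg : ContDiff ℝ 1 g)
    (r : ℝ → EuclideanSpace ℝ (Fin m))
    (hr : Differentiable ℝ r)
    (T : ℝ) (hT : 0 < T)
    (x : ℝ → EuclideanSpace ℝ (Fin n))
    (u : ℝ → EuclideanSpace ℝ (Fin m))
    (hx : ∀ t : ℝ, 0 ≤ t → HasDerivAt x (f (x t, u t)) t)
    (hu : ∀ t : ℝ, 0 ≤ t →
      ∃ J : EuclideanSpace ℝ (Fin m) ≃L[ℝ] EuclideanSpace ℝ (Fin m),
        (J : EuclideanSpace ℝ (Fin m) →L[ℝ] EuclideanSpace ℝ (Fin m)) =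
          fderiv ℝ (fun u' => g (x t, u')) (u t) ∧
        HasDerivAt u
          (J.symm (r (t + T) - g (x t, u t) + deriv r (t + T) -
            (fderiv ℝ (fun x' => g (x', u t)) (x t)) (f (x t, u t)))) t) :
    (∀ t : ℝ, 0 ≤ t →
      HasDerivAt (fun τ => (1 / 2 : ℝ) * ‖r (τ + T) - g (x τ, u τ)‖ ^ 2)
        (-2 * ((1 / 2 : ℝ) * ‖r (t + T) - g (x t, u t)‖ ^ 2)) t) ∧
    Tendsto (fun t => r (t + T) - g (x t, u t)) atTop (nhds 0) := by
  have he : ∀ t : ℝ, 0 ≤ t →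
      HasDerivAt (fun τ => r (τ + T) - g (x τ, u τ)) (-(r (t + T) - g (x t, u t))) t := by
    intro t ht
    obtain ⟨J, hJ, hJu⟩ := hu t ht
    have hgt := HasDerivAt.comp_prodMk_partial
      (hg.differentiable one_ne_zero (x t, u t)) (hx t ht) hJu
    have hrt : HasDerivAt (fun τ => r (τ + T)) (deriv r (t + T)) t :=
      (hr (t + T)).hasDerivAt.comp_add_const t T
    rw [← hJ, ContinuousLinearEquiv.coe_coe, ContinuousLinearEquiv.apply_symm_apply] at hgt
    exact (hrt.sub hgt).congr_deriv (by abel)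
  refine ⟨fun t ht => ?_, tendsto_zero_of_hasDerivAt_neg he⟩
  refine ((he t ht).norm_sq.const_mul (1 / 2 : ℝ)).congr_deriv ?_
  rw [inner_neg_right, real_inner_self_eq_norm_sq]
  ring
end

section
/- (Proposition 3.2) Let n, m ≥ 1, let f : ℝ^n × ℝ^m → ℝ^n be continuous, let g : ℝ^n × ℝ^m → ℝ^m be continuously differentiable, let r : ℝ → ℝ^m be differentiable, let T > 0, let E₂ : [0,∞) → ℝ^m be continuous with η₂ := limsup_{t→∞} ‖E₂(t)‖, and let x : [0,∞) → ℝ^n and u : [0,∞) → ℝ^m be differentiable functions satisfying, for every t ≥ 0: ẋ(t) = f(x(t),u(t)); D_u g(x(t),u(t)) is invertible; and u̇(t) = (D_u g(x(t),u(t)))⁻¹ ( r(t+T) − g(x(t),u(t)) + ṙ(t+T) − D_x g(x(t),u(t)) f(x(t),u(t)) + E₂(t) ). Then limsup_{t→∞} ‖r(t+T) − g(x(t),u(t))‖ ≤ η₂. -/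
open Filter Topology ENNReal

/-- If `e' = -e - E` on `[a, b]` and `‖E‖ ≤ c` there, then the part of `‖e‖` exceeding `c` decays
exponentially. -/
theorem norm_le_add_exp_of_hasDerivAt_neg_sub {V : Type*} [NormedAddCommGroup V] [NormedSpace ℝ V]
    {e E : ℝ → V} {a b c : ℝ} (hab : a ≤ b)
    (he : ∀ t, a ≤ t → HasDerivAt e (-e t - E t) t) (hE : ∀ t, a ≤ t → ‖E t‖ ≤ c) :
    ‖e b‖ ≤ c + (‖Real.exp a • e a‖ - c * Real.exp a) * Real.exp (-b) := by
  have hw : ∀ t, a ≤ t →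
      HasDerivAt (fun s => Real.exp s • e s) (-(Real.exp t • E t)) t := by
    intro t ht
    refine ((Real.hasDerivAt_exp t).smul (he t ht)).congr_deriv ?_
    rw [smul_sub, smul_neg]
    abel
  have hB : ∀ t, HasDerivAt
      (fun s => ‖Real.exp a • e a‖ - c * Real.exp a + c * Real.exp s) (c * Real.exp t) t :=
    fun t => ((Real.hasDerivAt_exp t).const_mul c).const_add _
  have key := image_norm_le_of_norm_deriv_right_le_deriv_boundary
    (f := fun s => Real.exp s • e s) (a := a) (b := b)
    (fun t ht => (hw t ht.1).continuousAt.continuousWithinAt)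
    (fun t ht => (hw t ht.1).hasDerivWithinAt) (by simp) hB
    (fun t ht => by
      rw [norm_neg, norm_smul, Real.norm_of_nonneg (Real.exp_pos t).le, mul_comm]
      exact mul_le_mul_of_nonneg_right (hE t ht.1) (Real.exp_pos t).le)
    (Set.right_mem_Icc.2 hab)
  rw [norm_smul (Real.exp b), Real.norm_of_nonneg (Real.exp_pos b).le] at key
  have hb : Real.exp b * Real.exp (-b) = 1 := by rw [← Real.exp_add]; simp
  calc ‖e b‖ = Real.exp b * ‖e b‖ * Real.exp (-b) := by linear_combination -‖e b‖ * hb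
    _ ≤ (‖Real.exp a • e a‖ - c * Real.exp a + c * Real.exp b) * Real.exp (-b) :=
        mul_le_mul_of_nonneg_right key (Real.exp_pos _).le
    _ = _ := by linear_combination c * hb

/-- Input-to-state bound with unit gain for the perturbed linear equation `e' = -e - E`. -/
theorem limsup_nnnorm_le_of_hasDerivAt_neg_sub {V : Type*} [NormedAddCommGroup V]
    [NormedSpace ℝ V] {e E : ℝ → V} (he : ∀ t, 0 ≤ t → HasDerivAt e (-e t - E t) t) :
    limsup (fun t => (‖e t‖₊ : ℝ≥0∞)) atTop ≤ limsup (fun t => (‖E t‖₊ : ℝ≥0∞)) atTop := by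
  refine le_of_forall_gt_imp_ge_of_dense fun c hc => ?_
  induction c with
  | top => exact le_top
  | coe c =>
    obtain ⟨a, ha0, ha⟩ :=
      (atTop_basis' (0 : ℝ)).eventually_iff.1 (eventually_lt_of_limsup_lt hc)
    have hE : ∀ t, a ≤ t → ‖E t‖ ≤ c := fun t ht =>
      NNReal.coe_le_coe.2 (ENNReal.coe_lt_coe.1 (ha ht)).le
    set K := ‖Real.exp a • e a‖ - c * Real.exp a
    have hlim : Tendsto (fun t => ENNReal.ofReal (c + K * Real.exp (-t))) atTop (𝓝 (c : ℝ≥0∞)) := by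
      have h : Tendsto (fun t => (c : ℝ) + K * Real.exp (-t)) atTop (𝓝 ((c : ℝ) + K * 0)) :=
        (Real.tendsto_exp_neg_atTop_nhds_zero.const_mul K).const_add _
      simpa using ENNReal.tendsto_ofReal h
    rw [← hlim.limsup_eq]
    refine limsup_le_limsup ?_
    filter_upwards [eventually_ge_atTop a] with t ht
    rw [← enorm_eq_nnnorm, ← ofReal_norm]
    exact ENNReal.ofReal_le_ofReal (norm_le_add_exp_of_hasDerivAt_neg_sub ht
      (fun s hs => he s (ha0.trans hs)) hE)

/-- Proposition 3.2: with an additive error `E₂` in the controller, the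
asymptotic prediction-tracking error is bounded by `η₂ = limsup ‖E₂(t)‖`. -/
theorem controller_with_error_tracking_bound
    (n m : ℕ) (hn : 1 ≤ n) (hm : 1 ≤ m)
    (f : EuclideanSpace ℝ (Fin n) × EuclideanSpace ℝ (Fin m) → EuclideanSpace ℝ (Fin n))
    (hf : Continuous f)
    (g : EuclideanSpace ℝ (Fin n) × EuclideanSpace ℝ (Fin m) → EuclideanSpace ℝ (Fin m))
    (hg : ContDiff ℝ 1 g)
    (r : ℝ → EuclideanSpace ℝ (Fin m))
    (hr : Differentiable ℝ r)
    (T : ℝ) (hT : 0 < T)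
    (E₂ : ℝ → EuclideanSpace ℝ (Fin m))
    (hE₂ : Continuous E₂)
    (x : ℝ → EuclideanSpace ℝ (Fin n))
    (u : ℝ → EuclideanSpace ℝ (Fin m))
    (hx : ∀ t : ℝ, 0 ≤ t → HasDerivAt x (f (x t, u t)) t)
    (hu : ∀ t : ℝ, 0 ≤ t →
      ∃ J : EuclideanSpace ℝ (Fin m) ≃L[ℝ] EuclideanSpace ℝ (Fin m),
        (J : EuclideanSpace ℝ (Fin m) →L[ℝ] EuclideanSpace ℝ (Fin m)) =
          fderiv ℝ (fun u' => g (x t, u')) (u t) ∧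
        HasDerivAt u
          (J.symm (r (t + T) - g (x t, u t) + deriv r (t + T) -
            (fderiv ℝ (fun x' => g (x', u t)) (x t)) (f (x t, u t)) + E₂ t)) t) :
    Filter.limsup (fun t => (‖r (t + T) - g (x t, u t)‖₊ : ℝ≥0∞)) Filter.atTop ≤
      Filter.limsup (fun t => (‖E₂ t‖₊ : ℝ≥0∞)) Filter.atTop := by
  refine limsup_nnnorm_le_of_hasDerivAt_neg_sub fun t ht => ?_
  obtain ⟨J, hJ, hut⟩ := hu t ht
  have hxt := hx t ht
  have hgt : HasFDerivAt g (fderiv ℝ g (x t, u t)) (x t, u t) :=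
    (hg.differentiable one_ne_zero _).hasFDerivAt
  have hgx := (HasFDerivAt.comp (f := fun x' => (x', u t)) (x t) hgt
    (hasFDerivAt_prodMk_left (x t) (u t))).fderiv
  have hgu := (HasFDerivAt.comp (f := fun u' => (x t, u')) (u t) hgt
    (hasFDerivAt_prodMk_right (x t) (u t))).fderiv
  have hJu := fun v => (DFunLike.congr_fun hJ v).trans (DFunLike.congr_fun hgu v)
  have hd := ((hr (t + T)).hasDerivAt.comp_add_const t T).sub
    (hgt.comp_hasDerivAt t (hxt.prodMk hut))
  set v := r (t + T) - g (x t, u t) + deriv r (t + T) -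
    (fderiv ℝ (fun x' => g (x', u t)) (x t)) (f (x t, u t)) + E₂ t with hv
  have hsplit : fderiv ℝ g (x t, u t) (f (x t, u t), J.symm v) =
      fderiv ℝ (fun x' => g (x', u t)) (x t) (f (x t, u t)) + v := by
    have h1 : fderiv ℝ (fun x' => g (x', u t)) (x t) (f (x t, u t)) =
        fderiv ℝ g (x t, u t) (f (x t, u t), 0) := DFunLike.congr_fun hgx _
    have h2 : J (J.symm v) = fderiv ℝ g (x t, u t) (0, J.symm v) := hJu (J.symm v)
    rw [J.apply_symm_apply] at h2
    nth_rewrite 2 [h2]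
    rw [h1, ← map_add]
    simp
  refine hd.congr_deriv ?_
  rw [hsplit, hv]
  abel
end

section
/- (Proposition 4.2, for the controller of Eq. (15)) Let n, m ≥ 1, f : ℝ^n × ℝ^m → ℝ^n continuous, g : ℝ^n × ℝ^m → ℝ^m continuously differentiable, r : ℝ → ℝ^m continuously differentiable with sup_t ‖ṙ(t)‖ < ∞, T > 0, and ᾱ > 0. Suppose there is a compact set K ⊂ ℝ^n × ℝ^m such that for every α ≥ ᾱ there exist differentiable x_α : [0,∞) → ℝ^n and u_α : [0,∞) → ℝ^m satisfying, for all t ≥ 0: ẋ_α(t) = f(x_α(t),u_α(t)); D_u g(x_α(t),u_α(t)) is invertible; u̇_α(t) = α (D_u g(x_α(t),u_α(t)))⁻¹ ( r(t+T) − g(x_α(t),u_α(t)) ); and (x_α(t),u_α(t)) ∈ K. Then lim_{α→∞} limsup_{t→∞} ‖r(t+T) − g(x_α(t),u_α(t))‖ = 0. -/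
open Filter Topology ENNReal

/-- A differentiable function whose derivative is a bounded perturbation of the exponentially
stable field `-α e` decays to a ball of radius `C / α`. -/
theorem norm_le_of_hasDerivAt_sub_smul {E : Type*} [NormedAddCommGroup E] [NormedSpace ℝ E]
    {e c : ℝ → E} {α C : ℝ} (hα : 0 < α)
    (he : ∀ t, 0 ≤ t → HasDerivAt e (c t - α • e t) t) (hc : ∀ t, 0 ≤ t → ‖c t‖ ≤ C)
    {t : ℝ} (ht : 0 ≤ t) :
    ‖e t‖ ≤ Real.exp (-(α * t)) * (‖e 0‖ - C / α) + C / α := by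
  have hexp (s : ℝ) : HasDerivAt (fun s => Real.exp (α * s)) (Real.exp (α * s) * α) s := by
    simpa using ((hasDerivAt_id s).const_mul α).exp
  have hV (s : ℝ) (hs : 0 ≤ s) :
      HasDerivAt (fun s => Real.exp (α * s) • e s) (Real.exp (α * s) • c s) s := by
    refine ((hexp s).smul (he s hs)).congr_deriv ?_
    module
  have hB (s : ℝ) : HasDerivAt (fun s => ‖e 0‖ + C / α * (Real.exp (α * s) - 1))
      (C * Real.exp (α * s)) s := by
    refine ((((hexp s).sub_const 1).const_mul (C / α)).const_add ‖e 0‖).congr_deriv ?_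
    field_simp
  have hle : ‖Real.exp (α * t) • e t‖ ≤ ‖e 0‖ + C / α * (Real.exp (α * t) - 1) := by
    refine image_norm_le_of_norm_deriv_right_le_deriv_boundary (a := 0) (b := t)
      (fun s hs => (hV s hs.1).continuousAt.continuousWithinAt)
      (fun s hs => (hV s hs.1).hasDerivWithinAt) (by simp) hB (fun s hs => ?_) ⟨ht, le_rfl⟩
    rw [norm_smul, Real.norm_of_nonneg (Real.exp_pos _).le, mul_comm]
    gcongr
    exact hc s hs.1
  rw [norm_smul, Real.norm_of_nonneg (Real.exp_pos _).le] at hle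
  have hinv : Real.exp (-(α * t)) * Real.exp (α * t) = 1 := by simp [← Real.exp_add]
  calc ‖e t‖ = Real.exp (-(α * t)) * (Real.exp (α * t) * ‖e t‖) := by
        rw [← mul_assoc, hinv, one_mul]
    _ ≤ Real.exp (-(α * t)) * (‖e 0‖ + C / α * (Real.exp (α * t) - 1)) := by gcongr
    _ = _ := by linear_combination C / α * hinv

/-- The upper limit of the norm of a solution of `e' = c - α e` is at most `C / α` when
`‖c‖ ≤ C`. -/
theorem limsup_nnnorm_le_of_hasDerivAt_sub_smul {E : Type*} [NormedAddCommGroup E]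
    [NormedSpace ℝ E] {e c : ℝ → E} {α C : ℝ} (hα : 0 < α)
    (he : ∀ t, 0 ≤ t → HasDerivAt e (c t - α • e t) t) (hc : ∀ t, 0 ≤ t → ‖c t‖ ≤ C) :
    limsup (fun t => (‖e t‖₊ : ℝ≥0∞)) atTop ≤ ENNReal.ofReal (C / α) := by
  have hexp : Tendsto (fun t : ℝ => Real.exp (-(α * t))) atTop (𝓝 0) :=
    Real.tendsto_exp_neg_atTop_nhds_zero.comp (tendsto_id.const_mul_atTop hα)
  have hlim : Tendsto
      (fun t => ENNReal.ofReal (Real.exp (-(α * t)) * (‖e 0‖ - C / α) + C / α)) atTop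
      (𝓝 (ENNReal.ofReal (C / α))) := by
    refine ENNReal.tendsto_ofReal ?_
    simpa using (hexp.mul_const (‖e 0‖ - C / α)).add_const (C / α)
  rw [← hlim.limsup_eq]
  refine limsup_le_limsup ?_
  filter_upwards [eventually_ge_atTop 0] with t ht
  rw [← enorm_eq_nnnorm, ← ofReal_norm]
  exact ENNReal.ofReal_le_ofReal (norm_le_of_hasDerivAt_sub_smul hα he hc ht)

/-- Proposition 4.2 (controller of Eq. (15)): if, for every gain `α ≥ ᾱ`, the
closed-loop trajectory stays in one fixed compact set `K`, then the asymptotic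
prediction-tracking error vanishes as `α → ∞`. -/
theorem alpha_stability_implies_asymptotic_tracking
    (n m : ℕ) (hn : 1 ≤ n) (hm : 1 ≤ m)
    (f : EuclideanSpace ℝ (Fin n) × EuclideanSpace ℝ (Fin m) → EuclideanSpace ℝ (Fin n))
    (hf : Continuous f)
    (g : EuclideanSpace ℝ (Fin n) × EuclideanSpace ℝ (Fin m) → EuclideanSpace ℝ (Fin m))
    (hg : ContDiff ℝ 1 g)
    (r : ℝ → EuclideanSpace ℝ (Fin m))
    (hr : ContDiff ℝ 1 r)
    (hrd : ∃ M : ℝ, ∀ t : ℝ, ‖deriv r t‖ ≤ M)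
    (T : ℝ) (hT : 0 < T)
    (ᾱ : ℝ) (hᾱ : 0 < ᾱ)
    (K : Set (EuclideanSpace ℝ (Fin n) × EuclideanSpace ℝ (Fin m)))
    (hK : IsCompact K)
    (x : ℝ → ℝ → EuclideanSpace ℝ (Fin n))
    (u : ℝ → ℝ → EuclideanSpace ℝ (Fin m))
    (hx : ∀ α : ℝ, ᾱ ≤ α → ∀ t : ℝ, 0 ≤ t → HasDerivAt (x α) (f (x α t, u α t)) t)
    (hu : ∀ α : ℝ, ᾱ ≤ α → ∀ t : ℝ, 0 ≤ t →
      ∃ J : EuclideanSpace ℝ (Fin m) ≃L[ℝ] EuclideanSpace ℝ (Fin m),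
        (J : EuclideanSpace ℝ (Fin m) →L[ℝ] EuclideanSpace ℝ (Fin m)) =
          fderiv ℝ (fun u' => g (x α t, u')) (u α t) ∧
        HasDerivAt (u α) (α • J.symm (r (t + T) - g (x α t, u α t))) t)
    (hKmem : ∀ α : ℝ, ᾱ ≤ α → ∀ t : ℝ, 0 ≤ t → (x α t, u α t) ∈ K) :
    Tendsto
      (fun α : ℝ =>
        Filter.limsup (fun t => (‖r (t + T) - g (x α t, u α t)‖₊ : ℝ≥0∞)) Filter.atTop)
      atTop (nhds 0) := by
  obtain ⟨M, hM⟩ := hrd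
  have hgdiff : Differentiable ℝ g := hg.differentiable one_ne_zero
  have hcont : Continuous fun z => fderiv ℝ g z (f z, 0) :=
    (hg.continuous_fderiv one_ne_zero).clm_apply (hf.prodMk continuous_const)
  obtain ⟨D, hD⟩ := hK.exists_bound_of_continuousOn hcont.continuousOn
  have hbound : ∀ᶠ α in atTop,
      limsup (fun t => (‖r (t + T) - g (x α t, u α t)‖₊ : ℝ≥0∞)) atTop
        ≤ ENNReal.ofReal ((M + D) / α) := by
    filter_upwards [eventually_ge_atTop ᾱ] with α hα
    refine limsup_nnnorm_le_of_hasDerivAt_sub_smul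
      (c := fun t => deriv r (t + T) - fderiv ℝ g (x α t, u α t) (f (x α t, u α t), 0))
      (hᾱ.trans_le hα) (fun t ht => ?_)
      fun t ht => (norm_sub_le _ _).trans (add_le_add (hM _) (hD _ (hKmem α hα t ht)))
    obtain ⟨J, hJ, hu'⟩ := hu α hα t ht
    have hpartial : fderiv ℝ (fun u' => g (x α t, u')) (u α t)
        = (fderiv ℝ g (x α t, u α t)).comp (ContinuousLinearMap.inr ℝ _ _) :=
      ((hgdiff _).hasFDerivAt.comp _ (hasFDerivAt_prodMk_right _ _)).fderiv
    have hsplit (v : EuclideanSpace ℝ (Fin n)) (w : EuclideanSpace ℝ (Fin m)) :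
        fderiv ℝ g (x α t, u α t) (v, w) = fderiv ℝ g (x α t, u α t) (v, 0) + J w := by
      have hJw : J w = fderiv ℝ g (x α t, u α t) (0, w) := by
        simpa using congrArg (fun L => L w) (hJ.trans hpartial)
      rw [hJw, ← map_add]
      simp
    have hgt := (hgdiff (x α t, u α t)).hasFDerivAt.comp_hasDerivAt t
      ((hx α hα t ht).prodMk hu')
    have hrt := (((hr.differentiable one_ne_zero) (t + T)).hasDerivAt).comp_add_const t T
    refine (hrt.sub hgt).congr_deriv ?_
    rw [hsplit, map_smul, J.apply_symm_apply]
    abel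
  have hzero : Tendsto (fun α : ℝ => ENNReal.ofReal ((M + D) / α)) atTop (𝓝 0) := by
    simpa using ENNReal.tendsto_ofReal (tendsto_const_nhds.div_atTop tendsto_id)
  exact tendsto_of_tendsto_of_tendsto_of_le_of_le' tendsto_const_nhds hzero
    (Eventually.of_forall fun _ => zero_le) hbound
end

section
/- (Lemma 4.3) Let n, m ≥ 1 and let φ_{j,i} (1 ≤ j,i ≤ n+m) be real numbers. For α ∈ ℝ, let Φ_α be the (n+m)×(n+m) real matrix whose (j,i) entry equals φ_{j,i} for j ≤ n and equals α·φ_{j,i} for j > n, and let P_α(s) := det(sI − Φ_α), a polynomial in the two variables α and s. Then there exist real polynomials P₀(s), P₁(s), …, P_m(s) in s, with deg P_i ≤ n + i for each i = 0, …, m, such that P_α(s) = Σ_{i=0}^{m} α^i P_{m−i}(s) for all α and s. -/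
open Matrix Polynomial Finset

/-- The real functions of `(α, s)` spanned by the monomials `α ^ i * s ^ l` with `i ≤ k` and
`i + l ≤ d`. -/
def boundedDegreeFunctions (k d : ℕ) : Submodule ℝ (ℝ × ℝ → ℝ) :=
  Submodule.span ℝ {f | ∃ i l : ℕ, i ≤ k ∧ i + l ≤ d ∧ f = fun p => p.1 ^ i * p.2 ^ l}

theorem monomial_mem_boundedDegreeFunctions {k d i l : ℕ} (hi : i ≤ k) (hil : i + l ≤ d) :
    (fun p : ℝ × ℝ => p.1 ^ i * p.2 ^ l) ∈ boundedDegreeFunctions k d :=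
  Submodule.subset_span ⟨i, l, hi, hil, rfl⟩

theorem mul_mem_boundedDegreeFunctions {k d k' d' : ℕ} {f g : ℝ × ℝ → ℝ}
    (hf : f ∈ boundedDegreeFunctions k d) (hg : g ∈ boundedDegreeFunctions k' d') :
    f * g ∈ boundedDegreeFunctions (k + k') (d + d') := by
  have h := Submodule.mul_mem_mul hf hg
  rw [boundedDegreeFunctions, boundedDegreeFunctions, Submodule.span_mul_span] at h
  refine Submodule.span_mono ?_ h
  rintro _ ⟨_, ⟨i, l, hi, hil, rfl⟩, _, ⟨i', l', hi', hil', rfl⟩, rfl⟩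
  refine ⟨i + i', l + l', by omega, by omega, ?_⟩
  funext p
  simp only [Pi.mul_apply]
  ring

theorem prod_mem_boundedDegreeFunctions {ι : Type*} (t : Finset ι) (k d : ι → ℕ)
    (f : ι → ℝ × ℝ → ℝ) (hf : ∀ i, f i ∈ boundedDegreeFunctions (k i) (d i)) :
    ∏ i ∈ t, f i ∈ boundedDegreeFunctions (∑ i ∈ t, k i) (∑ i ∈ t, d i) := by
  classical
  induction t using Finset.induction_on with
  | empty =>
    simpa [← Pi.one_def] using
      monomial_mem_boundedDegreeFunctions (k := 0) (d := 0) (i := 0) (l := 0) le_rfl le_rfl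
  | insert a t ha ih =>
    rw [Finset.prod_insert ha, Finset.sum_insert ha, Finset.sum_insert ha]
    exact mul_mem_boundedDegreeFunctions (hf a) ih

theorem exists_polynomial_of_mem_boundedDegreeFunctions {n m : ℕ} {f : ℝ × ℝ → ℝ}
    (hf : f ∈ boundedDegreeFunctions m (n + m)) :
    ∃ P : ℕ → Polynomial ℝ, (∀ i ≤ m, (P i).natDegree ≤ n + i) ∧
      ∀ α s : ℝ, f (α, s) = ∑ i ∈ Finset.range (m + 1), α ^ i * (P (m - i)).eval s := by
  induction hf using Submodule.span_induction with
  | mem f hf =>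
    obtain ⟨i, l, hi, hil, rfl⟩ := hf
    refine ⟨fun j => if j = m - i then X ^ l else 0, fun j hj => ?_, fun α s => ?_⟩
    · dsimp only
      split_ifs with h
      · rw [natDegree_X_pow]
        omega
      · simp
    · rw [Finset.sum_eq_single i]
      · simp
      · intro j hj hji
        have : m - j ≠ m - i := by
          have := Finset.mem_range.mp hj
          omega
        simp [this]
      · intro h
        exact absurd (Finset.mem_range.mpr (by omega)) h
  | zero => exact ⟨0, by simp, by simp⟩
  | add f g _ _ hf hg =>
    obtain ⟨P, hP, hfP⟩ := hf
    obtain ⟨Q, hQ, hgQ⟩ := hg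
    refine ⟨P + Q, fun i hi => natDegree_add_le_of_degree_le (hP i hi) (hQ i hi), fun α s => ?_⟩
    simp [hfP, hgQ, mul_add, Finset.sum_add_distrib]
  | smul c f _ hf =>
    obtain ⟨P, hP, hfP⟩ := hf
    refine ⟨c • P, fun i hi => (natDegree_smul_le c (P i)).trans (hP i hi), fun α s => ?_⟩
    simp [hfP, Finset.mul_sum, mul_left_comm]

/-- Lemma 4.3: the characteristic polynomial of the closed-loop matrix `Φ_α`
(whose last `m` rows carry the multiplicative gain `α`) decomposes as
`P_α(s) = Σ_{i=0}^{m} α^i P_{m−i}(s)` with `deg P_i ≤ n + i`. -/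
theorem char_poly_alpha_decomposition
    (n m : ℕ) (hn : 1 ≤ n) (hm : 1 ≤ m)
    (φ : Fin (n + m) → Fin (n + m) → ℝ) :
    ∃ P : ℕ → Polynomial ℝ,
      (∀ i ≤ m, (P i).natDegree ≤ n + i) ∧
      ∀ α s : ℝ,
        Matrix.det
          (s • (1 : Matrix (Fin (n + m)) (Fin (n + m)) ℝ) -
            Matrix.of (fun (j i : Fin (n + m)) => if (j : ℕ) < n then φ j i else α * φ j i)) =
        ∑ i ∈ Finset.range (m + 1), α ^ i * (P (m - i)).eval s := by
  let M : Fin (n + m) → Fin (n + m) → ℝ × ℝ → ℝ := fun j i p =>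
    p.2 * (1 : Matrix (Fin (n + m)) (Fin (n + m)) ℝ) j i -
      if (j : ℕ) < n then φ j i else p.1 * φ j i
  let k : Fin (n + m) → ℕ := fun j => if (j : ℕ) < n then 0 else 1
  have hM : ∀ j i, M j i ∈ boundedDegreeFunctions (k j) 1 := by
    intro j i
    have hs := Submodule.smul_mem _ ((1 : Matrix (Fin (n + m)) (Fin (n + m)) ℝ) j i)
      (monomial_mem_boundedDegreeFunctions (k := k j) (d := 1) (i := 0) (l := 1)
        (Nat.zero_le _) le_rfl)
    have hφ := Submodule.smul_mem _ (φ j i)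
      (monomial_mem_boundedDegreeFunctions (k := k j) (d := 1) (i := k j) (l := 0)
        le_rfl (by simp only [k]; split_ifs <;> simp))
    convert Submodule.sub_mem _ hs hφ using 1
    funext p
    by_cases h : (j : ℕ) < n <;> simp [M, k, h, mul_comm]
  have hk : ∑ j, k j = m := by
    simp [k, Fin.sum_univ_add]
  have hdet : (∑ σ : Equiv.Perm (Fin (n + m)),
      ((Equiv.Perm.sign σ : ℤ) : ℝ) • ∏ i, M (σ i) i) ∈ boundedDegreeFunctions m (n + m) := by
    refine Submodule.sum_mem _ fun σ _ => Submodule.smul_mem _ _ ?_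
    have h := prod_mem_boundedDegreeFunctions Finset.univ (fun i => k (σ i)) (fun _ => 1)
      (fun i => M (σ i) i) fun i => hM (σ i) i
    rw [Equiv.sum_comp σ k, hk] at h
    simpa using h
  obtain ⟨P, hP, h⟩ := exists_polynomial_of_mem_boundedDegreeFunctions hdet
  refine ⟨P, hP, fun α s => ?_⟩
  rw [← h, Matrix.det_apply']
  simp [M]
end

section
/- (Lemma 4.6) Let n, m ≥ 1 and let P₀, P₁, …, P_m be complex (or real) polynomials with deg P_i = n + i for each i (in particular deg P₀ = n). Let s : [0,∞) → ℂ be a continuous function such that Σ_{i=0}^{m} α^i P_{m−i}(s(α)) = 0 for every α ≥ 0, and suppose {s(α) : α ≥ 0} is bounded. Then the limit lim_{α→∞} s(α) exists and is a root of P₀. -/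
open Filter Topology Polynomial Finset

/-- A bounded continuous curve along which a continuous function with finitely many zeros
tends to zero converges to one of these zeros. -/
theorem exists_tendsto_of_tendsto_zero_of_finite_zeros {f : ℂ → ℂ} (hf : Continuous f)
    (hfin : {z | f z = 0}.Finite) {s : ℝ → ℂ} {a M : ℝ} (hs : ContinuousOn s (Set.Ici a))
    (hM : ∀ x, a ≤ x → ‖s x‖ ≤ M) (hfs : Tendsto (fun x => f (s x)) atTop (𝓝 0)) :
    ∃ l, Tendsto s atTop (𝓝 l) ∧ f l = 0 := by
  have hcluster : ∀ z, MapClusterPt z atTop s → f z = 0 := fun z hz => by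
    have h : MapClusterPt (f z) atTop (f ∘ s) := hz.continuousAt_comp hf.continuousAt
    have h' : ClusterPt (f z) (𝓝 0) := ClusterPt.mono h hfs
    exact eq_of_nhds_neBot h'
  have hmem : ∃ᶠ x in atTop, s x ∈ Metric.closedBall (0 : ℂ) M :=
    ((eventually_ge_atTop a).mono fun x hx => by simpa using hM x hx).frequently
  obtain ⟨l, -, hl⟩ := (isCompact_closedBall (0 : ℂ) M).exists_mapClusterPt_of_frequently hmem
  refine ⟨l, Metric.tendsto_nhds.2 fun ε hε => ?_, hcluster l hl⟩
  obtain ⟨r, ⟨hr0, hrε⟩, hr⟩ :=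
    (Set.Ioo_infinite hε).exists_notMem_finite (hfin.image fun z => dist z l)
  have hsphere : ∀ᶠ x in atTop, s x ∉ Metric.sphere l r := by
    by_contra hfreq
    obtain ⟨z, hz, hz'⟩ := (isCompact_sphere l r).exists_mapClusterPt_of_frequently
      (not_eventually.1 hfreq |>.mono fun x hx => not_not.1 hx)
    exact hr ⟨z, hcluster z hz', hz⟩
  obtain ⟨A, hA⟩ := eventually_atTop.1 (hsphere.and (eventually_ge_atTop a))
  have hnear : ∃ᶠ x in atTop, s x ∈ Metric.ball l r := hl.frequently (Metric.ball_mem_nhds l hr0)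
  obtain ⟨B, hB, hAB⟩ := (hnear.and_eventually (eventually_ge_atTop A)).exists
  filter_upwards [eventually_ge_atTop B] with x hx
  refine lt_trans (lt_of_not_ge fun hge => ?_) hrε
  have hcont : ContinuousOn (fun y => dist (s y) l) (Set.Icc B x) :=
    continuous_dist.comp_continuousOn
      ((hs.mono fun y hy => (hA B hAB).2.trans hy.1).prodMk continuousOn_const)
  obtain ⟨y, hy, hyr⟩ := intermediate_value_Icc hx hcont ⟨(Metric.mem_ball.1 hB).le, hge⟩
  exact (hA y (hAB.trans hy.1)).1 hyr

/-- A polynomial is bounded along a bounded curve. -/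
theorem Polynomial.exists_norm_eval_le_of_norm_le (p : ℂ[X]) (M : ℝ) :
    ∃ C, ∀ z : ℂ, ‖z‖ ≤ M → ‖p.eval z‖ ≤ C := by
  obtain ⟨C, hC⟩ :=
    (isCompact_closedBall (0 : ℂ) M).exists_bound_of_continuousOn p.continuous.continuousOn
  exact ⟨C, fun z hz => hC z (by simpa using hz)⟩

/-- Along a bounded curve of zeros of `∑ α ^ i * P (m - i)`, the coefficient `P 0` of the top
power of `α` tends to zero. -/
theorem tendsto_eval_zero_of_bounded_branch {m : ℕ} {P : ℕ → ℂ[X]} {s : ℝ → ℂ} {M : ℝ}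
    (hroot : ∀ α : ℝ, 0 ≤ α →
      ∑ i ∈ Finset.range (m + 1), (α : ℂ) ^ i * (P (m - i)).eval (s α) = 0)
    (hM : ∀ α : ℝ, 0 ≤ α → ‖s α‖ ≤ M) :
    Tendsto (fun α => (P 0).eval (s α)) atTop (𝓝 0) := by
  have hterm : ∀ i ∈ Finset.range m,
      Tendsto (fun α : ℝ => ((α : ℂ)⁻¹) ^ (m - i) * (P (m - i)).eval (s α)) atTop (𝓝 0) := by
    intro i hi
    have him : m - i ≠ 0 := Nat.sub_ne_zero_of_lt (Finset.mem_range.1 hi)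
    obtain ⟨C, hC⟩ := (P (m - i)).exists_norm_eval_le_of_norm_le M
    have hinv : Tendsto (fun α : ℝ => ((α : ℂ)⁻¹) ^ (m - i)) atTop (𝓝 0) := by
      have h := (Complex.continuous_ofReal.tendsto 0).comp
        ((tendsto_inv_atTop_zero (𝕜 := ℝ)).pow (m - i) |>.trans_eq (by simp [him]))
      simpa [Function.comp_def] using h
    refine hinv.zero_mul_isBoundedUnder_le (isBoundedUnder_of_eventually_le (a := C) ?_)
    exact (eventually_ge_atTop 0).mono fun α hα => hC _ (hM α hα)
  have hsum := (tendsto_finsetSum _ hterm).neg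
  simp only [Finset.sum_const_zero, neg_zero] at hsum
  refine hsum.congr' ?_
  filter_upwards [eventually_gt_atTop 0] with α hα
  have hα0 : (α : ℂ) ≠ 0 := by exact_mod_cast hα.ne'
  have h := hroot α hα.le
  rw [Finset.sum_range_succ, Nat.sub_self] at h
  apply mul_left_cancel₀ (pow_ne_zero m hα0)
  rw [mul_neg, Finset.mul_sum, neg_eq_iff_add_eq_zero, ← h]
  congr 1
  refine Finset.sum_congr rfl fun i hi => ?_
  rw [← mul_assoc]
  congr 1
  have hi' : m = i + (m - i) := by have := Finset.mem_range.1 hi; omega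
  nth_rewrite 1 [hi']
  rw [pow_add, mul_assoc, ← mul_pow, mul_inv_cancel₀ hα0, one_pow, mul_one]

/-- Lemma 4.6: a bounded branch `s(α)` of the root locus of
`P_α(s) = Σ_{i=0}^m α^i P_{m−i}(s)` converges, as `α → ∞`, to a root of `P₀`. -/
theorem bounded_root_locus_branch_converges_to_root
    (n m : ℕ) (hn : 1 ≤ n) (hm : 1 ≤ m)
    (P : ℕ → Polynomial ℂ)
    (hdeg : ∀ i ≤ m, (P i).natDegree = n + i)
    (s : ℝ → ℂ)
    (hs : ContinuousOn s (Set.Ici (0:ℝ)))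
    (hroot : ∀ α : ℝ, 0 ≤ α →
      ∑ i ∈ Finset.range (m + 1), (α : ℂ) ^ i * (P (m - i)).eval (s α) = 0)
    (hbdd : ∃ M : ℝ, ∀ α : ℝ, 0 ≤ α → ‖s α‖ ≤ M) :
    ∃ l : ℂ, Tendsto s atTop (nhds l) ∧ (P 0).eval l = 0 := by
  obtain ⟨M, hM⟩ := hbdd
  have hP : P 0 ≠ 0 := by
    rintro h
    have := hdeg 0 (Nat.zero_le m)
    rw [h, natDegree_zero] at this
    omega
  exact exists_tendsto_of_tendsto_zero_of_finite_zeros (P 0).continuous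
    (finite_setOfPred_isRoot hP) hs hM (tendsto_eval_zero_of_bounded_branch hroot hM)
end

section
/- (Lemma 4.7) Let n, m ≥ 1 and for i = 0,…,m let P_i(s) = Σ_{j=0}^{n+i} a_{i,j} s^j be complex polynomials with a_{i,n+i} ≠ 0 for every i and with a_{m,n+m} = 1 (P_m is monic of degree n+m). Let s : [0,∞) → ℂ satisfy Σ_{i=0}^{m} α^i P_{m−i}(s(α)) = 0 for all α ≥ 0, and let A ⊆ [0,∞) be an unbounded set with lim_{α→∞, α∈A} |s(α)| = ∞. Then there exist constants C > c > 0 such that c ≤ liminf_{α→∞, α∈A} |s(α)|/α and limsup_{α→∞, α∈A} |s(α)|/α ≤ C. -/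
open Filter Topology Finset ENNReal

/-- If `x, y` is a zero of a binary form of degree `m` whose coefficients are bounded by `B` and
whose coefficient at `x ^ m` has norm at least `β`, then `x` is controlled by `y`. -/
lemma norm_le_of_binary_form_eq_zero {m : ℕ} (hm : 1 ≤ m) {b : ℕ → ℂ} {B β : ℝ} (hβ : 0 < β)
    (hB : ∀ i ≤ m, ‖b i‖ ≤ B) (hbm : β ≤ ‖b m‖) {x y : ℂ}
    (h : ∑ i ∈ Finset.range (m + 1), x ^ i * y ^ (m - i) * b i = 0) :
    ‖x‖ ≤ (1 + m * B / β) * ‖y‖ := by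
  have hB0 : 0 ≤ B := (norm_nonneg _).trans (hB m le_rfl)
  have hK : 0 ≤ m * B / β * ‖y‖ := by positivity
  rcases le_or_gt ‖x‖ ‖y‖ with hxy | hxy
  · linarith
  have hx : 0 < ‖x‖ := (norm_nonneg y).trans_lt hxy
  rw [Finset.sum_range_succ, Nat.sub_self, pow_zero, mul_one] at h
  have hsum : ‖x ^ m * b m‖ ≤ m * (B * (‖x‖ ^ (m - 1) * ‖y‖)) := by
    rw [eq_neg_of_add_eq_zero_right h, norm_neg]
    refine (norm_sum_le_of_le (f := fun i => x ^ i * y ^ (m - i) * b i)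
      (n := fun _ => B * (‖x‖ ^ (m - 1) * ‖y‖)) _ fun i hi => ?_).trans (by simp)
    have him := Finset.mem_range.mp hi
    obtain ⟨k, rfl⟩ : ∃ k, m = i + k + 1 := ⟨m - i - 1, by omega⟩
    rw [show i + k + 1 - i = k + 1 by omega, show i + k + 1 - 1 = i + k by omega, norm_mul,
      norm_mul, norm_pow, norm_pow, mul_comm]
    refine mul_le_mul (hB i (by omega)) ?_ (by positivity) hB0
    rw [pow_succ, pow_add, mul_assoc]
    gcongr
  obtain ⟨k, rfl⟩ : ∃ k, m = k + 1 := ⟨m - 1, by omega⟩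
  rw [norm_mul, norm_pow, Nat.add_sub_cancel] at hsum
  have hpow : 0 < ‖x‖ ^ k := by positivity
  have h1 : ‖x‖ ^ k * (‖x‖ * β) ≤ ‖x‖ ^ k * (((k + 1 : ℕ) : ℝ) * B * ‖y‖) := by
    calc ‖x‖ ^ k * (‖x‖ * β) = ‖x‖ ^ (k + 1) * β := by ring
      _ ≤ ‖x‖ ^ (k + 1) * ‖b (k + 1)‖ := by gcongr
      _ ≤ _ := hsum
      _ = _ := by ring
  have h2 := le_of_mul_le_mul_left h1 hpow
  have h3 : ‖x‖ ≤ ((k + 1 : ℕ) : ℝ) * B / β * ‖y‖ := by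
    rw [div_mul_eq_mul_div, le_div_iff₀ hβ]
    exact h2
  linarith [norm_nonneg y]

/-- A polynomial expression is its top power times a polynomial expression in the inverse. -/
lemma sum_mul_pow_eq_pow_mul_sum_inv (c : ℕ → ℂ) (N : ℕ) {z : ℂ} (hz : z ≠ 0) :
    ∑ j ∈ Finset.range (N + 1), c j * z ^ j =
      z ^ N * ∑ j ∈ Finset.range (N + 1), c j * z⁻¹ ^ (N - j) := by
  rw [Finset.mul_sum]
  refine Finset.sum_congr rfl fun j hj => ?_
  obtain ⟨k, rfl⟩ := Nat.exists_eq_add_of_le (Nat.lt_succ_iff.mp (Finset.mem_range.mp hj))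
  rw [Nat.add_sub_cancel_left, pow_add, inv_pow]
  field_simp

/-- The reversed polynomial expression tends to the leading coefficient at `0`. -/
lemma tendsto_sum_mul_pow_sub (c : ℕ → ℂ) (N : ℕ) :
    Tendsto (fun t : ℂ => ∑ j ∈ Finset.range (N + 1), c j * t ^ (N - j)) (𝓝 0) (𝓝 (c N)) := by
  have hcont : Continuous fun t : ℂ => ∑ j ∈ Finset.range (N + 1), c j * t ^ (N - j) := by
    fun_prop
  have h0 : ∑ j ∈ Finset.range (N + 1), c j * (0 : ℂ) ^ (N - j) = c N := by
    rw [Finset.sum_range_succ, Finset.sum_eq_zero]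
    · simp
    · intro j hj
      have := Finset.mem_range.mp hj
      rw [zero_pow (by omega), mul_zero]
  simpa only [h0] using hcont.tendsto 0

/-- Lemma 4.7: an unbounded branch `s(α)` of the root locus of
`P_α(s) = Σ_{i=0}^m α^i P_{m−i}(s)` (where `P_i(s) = Σ_{j=0}^{n+i} a_{i,j} s^j`
has exact degree `n+i` and `P_m` is monic) grows linearly in `α`:
`|s(α)|/α` has positive liminf and finite limsup along the unbounded set `A`. -/
theorem unbounded_root_locus_branch_linear_growth
    (n m : ℕ) (hn : 1 ≤ n) (hm : 1 ≤ m)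
    (a : ℕ → ℕ → ℂ)
    (hlead : ∀ i ≤ m, a i (n + i) ≠ 0)
    (hmonic : a m (n + m) = 1)
    (s : ℝ → ℂ)
    (hroot : ∀ α : ℝ, 0 ≤ α →
      ∑ i ∈ Finset.range (m + 1), (α : ℂ) ^ i *
        ∑ j ∈ Finset.range (n + (m - i) + 1), a (m - i) j * (s α) ^ j = 0)
    (A : Set ℝ) (hA : A ⊆ Set.Ici (0:ℝ)) (hAunbdd : ¬ BddAbove A)
    (hsinf : Tendsto (fun α => ‖s α‖) (atTop ⊓ 𝓟 A) atTop) :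
    ∃ c C : ℝ, 0 < c ∧ c < C ∧
      ENNReal.ofReal c ≤
        Filter.liminf (fun α => ENNReal.ofReal (‖s α‖ / α)) (atTop ⊓ 𝓟 A) ∧
      Filter.limsup (fun α => ENNReal.ofReal (‖s α‖ / α)) (atTop ⊓ 𝓟 A) ≤
        ENNReal.ofReal C := by
  have hinv : Tendsto (fun α => (s α)⁻¹) (atTop ⊓ 𝓟 A) (𝓝 0) :=
    tendsto_inv₀_cobounded.comp (tendsto_norm_atTop_iff_cobounded.mp hsinf)
  set b : ℝ → ℕ → ℂ := fun α i => ∑ j ∈ Finset.range (n + (m - i) + 1),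
    a (m - i) j * (s α)⁻¹ ^ (n + (m - i) - j)
  have hlim (i : ℕ) : Tendsto (fun α => ‖b α i‖) (atTop ⊓ 𝓟 A)
      (𝓝 ‖a (m - i) (n + (m - i))‖) :=
    ((tendsto_sum_mul_pow_sub (a (m - i)) (n + (m - i))).comp hinv).norm
  set B : ℝ := 1 + ∑ i ∈ Finset.range (m + 1), ‖a (m - i) (n + (m - i))‖
  have hbB : ∀ᶠ α in atTop ⊓ 𝓟 A, ∀ i ∈ Finset.range (m + 1), ‖b α i‖ ≤ B := by
    rw [Filter.eventually_all_finset]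
    intro i hi
    refine (hlim i).eventually_le_const ?_
    have := Finset.single_le_sum (f := fun i => ‖a (m - i) (n + (m - i))‖)
      (fun _ _ => norm_nonneg _) hi
    linarith
  have hβ : 0 < ‖a 0 n‖ / 2 := half_pos (norm_pos_iff.mpr (by simpa using hlead 0 (Nat.zero_le m)))
  have hbm : ∀ᶠ α in atTop ⊓ 𝓟 A, ‖a 0 n‖ / 2 ≤ ‖b α m‖ := by
    refine (hlim m).eventually_const_le ?_
    rw [Nat.sub_self, Nat.add_zero]
    linarith
  have hb0 : ∀ᶠ α in atTop ⊓ 𝓟 A, 1 / 2 ≤ ‖b α 0‖ := by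
    refine (hlim 0).eventually_const_le ?_
    rw [Nat.sub_zero, hmonic, norm_one]
    norm_num
  have hB0 : 0 ≤ B := by positivity
  set K : ℝ := 1 + m * B / (‖a 0 n‖ / 2)
  set L : ℝ := 1 + m * B / (1 / 2)
  have hK0 : 1 ≤ K := le_add_of_nonneg_right (by positivity)
  have hL0 : 1 ≤ L := le_add_of_nonneg_right (by positivity)
  have hbounds : ∀ᶠ α in atTop ⊓ 𝓟 A, K⁻¹ ≤ ‖s α‖ / α ∧ ‖s α‖ / α ≤ L := by
    have hpos : ∀ᶠ α : ℝ in atTop ⊓ 𝓟 A, 0 < α := (eventually_gt_atTop 0).filter_mono inf_le_left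
    filter_upwards [hbB, hbm, hb0, hpos, hsinf.eventually_gt_atTop 0] with α hB' hm' h0' hα hs
    have hsα : s α ≠ 0 := norm_pos_iff.mp hs
    have hform : ∑ i ∈ Finset.range (m + 1), (α : ℂ) ^ i * s α ^ (m - i) * b α i = 0 := by
      refine (mul_eq_zero.mp ?_).resolve_left (pow_ne_zero n hsα)
      rw [← hroot α hα.le, Finset.mul_sum]
      refine Finset.sum_congr rfl fun i _ => ?_
      rw [sum_mul_pow_eq_pow_mul_sum_inv _ _ hsα, pow_add]
      ring
    have hform' : ∑ i ∈ Finset.range (m + 1),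
        s α ^ i * (α : ℂ) ^ (m - i) * b α (m - i) = 0 := by
      rw [← hform, ← Finset.sum_range_reflect]
      refine Finset.sum_congr rfl fun i hi => ?_
      have := Finset.mem_range.mp hi
      rw [show m + 1 - 1 - i = m - i by omega, show m - (m - i) = i by omega]
      ring
    have hnorm : ‖(α : ℂ)‖ = α := by rw [Complex.norm_real, Real.norm_of_nonneg hα.le]
    have hle := norm_le_of_binary_form_eq_zero hm hβ
      (fun i hi => hB' i (Finset.mem_range.mpr (by omega))) hm' hform
    have hge := norm_le_of_binary_form_eq_zero (b := fun i => b α (m - i)) hm one_half_pos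
      (fun i _ => hB' (m - i) (Finset.mem_range.mpr (by omega))) (by simpa using h0') hform'
    rw [hnorm] at hle hge
    refine ⟨?_, (div_le_iff₀ hα).mpr hge⟩
    rw [le_div_iff₀ hα, inv_mul_le_iff₀ (by linarith)]
    exact hle
  refine ⟨K⁻¹, L + 1, by positivity, ?_, ?_, ?_⟩
  · linarith [inv_le_one_of_one_le₀ hK0]
  · exact le_liminf_of_le (by isBoundedDefault)
      (hbounds.mono fun α h => ENNReal.ofReal_le_ofReal h.1)
  · exact limsup_le_of_le (by isBoundedDefault)
      (hbounds.mono fun α h => ENNReal.ofReal_le_ofReal (by linarith [h.2]))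
end

section
/- (Theorem 4.5, Hurwitz part) Let n, m ≥ 1 and for i = 0,…,m let P_i(s) = Σ_{j=0}^{n+i} a_{i,j} s^j be real polynomials with a_{i,n+i} ≠ 0 for every i and a_{m,n+m} = 1, and set P_α(s) := Σ_{i=0}^{m} α^i P_{m−i}(s) and Q(s) := Σ_{i=0}^{m} a_{m−i,n+m−i} s^{m−i}. Suppose every complex root of P₀ and every complex root of Q has strictly negative real part. Then there exists ᾱ ≥ 0 such that for every α ≥ ᾱ, every complex root of the polynomial P_α(·) has strictly negative real part. -/
open Finset Topology

theorem eventually_forall_ne_zero_of_isCompact {X Y : Type*} [TopologicalSpace X]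
    [TopologicalSpace Y] {K : Set Y} (hK : IsCompact K) {f : X → Y → ℂ}
    (hf : Continuous fun p : X × Y => f p.1 p.2) {x₀ : X} (h : ∀ y ∈ K, f x₀ y ≠ 0) :
    ∀ᶠ x in 𝓝 x₀, ∀ y ∈ K, f x y ≠ 0 :=
  hK.eventually_forall_of_forall_eventually fun y hy =>
    hf.continuousAt.eventually_ne (h y hy)

/-- If `P₀` has no zero in the closed right half-plane, then for large `α` the polynomial `P_α`
has no zero in any fixed bounded part of it. -/
theorem exists_forall_le_ne_zero_of_norm_le (n m : ℕ) (a : ℕ → ℕ → ℝ)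
    (hP0 : ∀ z : ℂ, (∑ j ∈ Finset.range (n + 1), (a 0 j : ℂ) * z ^ j) = 0 → z.re < 0) (R : ℝ) :
    ∃ A : ℝ, 0 < A ∧ ∀ α : ℝ, A ≤ α → ∀ z : ℂ, 0 ≤ z.re → ‖z‖ ≤ R →
      (∑ i ∈ Finset.range (m + 1), (α : ℂ) ^ i *
        ∑ j ∈ Finset.range (n + (m - i) + 1), (a (m - i) j : ℂ) * z ^ j) ≠ 0 := by
  have hK : IsCompact {z : ℂ | z ∈ Metric.closedBall (0 : ℂ) R ∧ 0 ≤ z.re} :=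
    (isCompact_closedBall (0 : ℂ) R).inter_right
      (isClosed_le continuous_const Complex.continuous_re)
  have hev := eventually_forall_ne_zero_of_isCompact hK (x₀ := (0 : ℂ))
    (f := fun u z => ∑ i ∈ Finset.range (m + 1), u ^ (m - i) *
      ∑ j ∈ Finset.range (n + (m - i) + 1), (a (m - i) j : ℂ) * z ^ j)
    (by fun_prop) (by
      rintro z ⟨-, hz⟩ h
      rw [Finset.sum_eq_single m] at h
      · exact (hP0 z (by simpa using h)).not_ge hz
      · intro i hi him
        have : i < m := by grind
        rw [zero_pow (by omega), zero_mul]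
      · simp)
  obtain ⟨ε, hε, hball⟩ := Metric.eventually_nhds_iff.1 hev
  refine ⟨2 / ε, by positivity, fun α hα z hz hzR h => ?_⟩
  have hα0 : 0 < α := lt_of_lt_of_le (by positivity) hα
  have hαC : (α : ℂ) ≠ 0 := by exact_mod_cast hα0.ne'
  have hsmall : dist ((α : ℂ)⁻¹) 0 < ε := by
    rw [dist_zero_right, norm_inv, Complex.norm_real, Real.norm_of_nonneg hα0.le,
      inv_lt_comm₀ hα0 hε]
    refine lt_of_lt_of_le ?_ hα
    rw [div_eq_mul_inv]
    linarith [inv_pos.2 hε]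
  refine hball hsmall z ⟨by simpa using hzR, hz⟩ ?_
  rw [← mul_zero (((α : ℂ)⁻¹) ^ m), ← h, Finset.mul_sum]
  refine Finset.sum_congr rfl fun i hi => ?_
  obtain ⟨k, rfl⟩ := Nat.exists_eq_add_of_le (Nat.lt_succ_iff.1 (Finset.mem_range.1 hi))
  rw [Nat.add_sub_cancel_left, pow_add, ← mul_assoc, mul_right_comm (_ ^ i) (_ ^ k), ← mul_pow,
    inv_mul_cancel₀ hαC, one_pow, one_mul]

/-- The homogenization of a polynomial with a nonzero leading coefficient and no zero in the closed
right half-plane does not vanish on nonzero pairs `(p, q)` with `p` in that half-plane and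
`q ≥ 0`. -/
theorem homogenization_ne_zero (m : ℕ) (c : ℕ → ℂ) (hc : c m ≠ 0)
    (hQ : ∀ z : ℂ, (∑ i ∈ Finset.range (m + 1), c (m - i) * z ^ (m - i)) = 0 → z.re < 0)
    {p q : ℂ} (hp : 0 ≤ p.re) (hq : 0 ≤ q.re) (hqi : q.im = 0) (hpq : ‖p‖ + ‖q‖ = 1) :
    (∑ i ∈ Finset.range (m + 1), c (m - i) * (q ^ i * p ^ (m - i))) ≠ 0 := by
  intro h
  by_cases hq0 : q = 0
  · subst hq0
    rw [Finset.sum_eq_single 0] at h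
    · have hp0 : p ≠ 0 := by
        rintro rfl
        simp at hpq
      simp [hc, hp0] at h
    · intro i _ hi
      simp [hi]
    · simp
  · have hre : 0 ≤ (p / q).re := by
      rw [Complex.div_re, hqi]
      have := Complex.normSq_nonneg q
      simp only [mul_zero, zero_div, add_zero]
      positivity
    refine (hQ (p / q) ?_).not_ge hre
    have hqm : q ^ m ≠ 0 := pow_ne_zero _ hq0
    rw [← mul_right_inj' hqm, mul_zero, ← h, Finset.mul_sum]
    refine Finset.sum_congr rfl fun i hi => ?_
    obtain ⟨k, rfl⟩ := Nat.exists_eq_add_of_le (Nat.lt_succ_iff.1 (Finset.mem_range.1 hi))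
    rw [Nat.add_sub_cancel_left, div_pow, pow_add]
    field_simp

/-- If `Q` has no zero in the closed right half-plane, then for large `α` the polynomial `P_α`
has no zero of large modulus there. -/
theorem exists_forall_le_ne_zero_of_le_norm (n m : ℕ) (a : ℕ → ℕ → ℝ)
    (hlead : a m (n + m) ≠ 0)
    (hQ : ∀ z : ℂ,
      (∑ i ∈ Finset.range (m + 1), (a (m - i) (n + (m - i)) : ℂ) * z ^ (m - i)) = 0 →
      z.re < 0) :
    ∃ R : ℝ, 0 < R ∧ ∀ α : ℝ, R ≤ α → ∀ z : ℂ, 0 ≤ z.re → R ≤ ‖z‖ →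
      (∑ i ∈ Finset.range (m + 1), (α : ℂ) ^ i *
        ∑ j ∈ Finset.range (n + (m - i) + 1), (a (m - i) j : ℂ) * z ^ j) ≠ 0 := by
  have hK : IsCompact {x : ℂ × ℂ | x ∈ Metric.closedBall (0 : ℂ × ℂ) 1 ∧
      (0 ≤ x.1.re ∧ 0 ≤ x.2.re ∧ x.2.im = 0 ∧ ‖x.1‖ + ‖x.2‖ = 1)} := by
    refine (isCompact_closedBall (0 : ℂ × ℂ) 1).inter_right
      (t := {x | 0 ≤ x.1.re ∧ 0 ≤ x.2.re ∧ x.2.im = 0 ∧ ‖x.1‖ + ‖x.2‖ = 1}) ?_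
    simp only [Set.ofPred_and]
    repeat' apply IsClosed.inter
    · exact isClosed_le (by fun_prop) (by fun_prop)
    · exact isClosed_le (by fun_prop) (by fun_prop)
    · exact isClosed_eq (by fun_prop) (by fun_prop)
    · exact isClosed_eq (by fun_prop) (by fun_prop)
  have hev := eventually_forall_ne_zero_of_isCompact hK (x₀ := (0 : ℂ × ℂ))
    (f := fun y x => ∑ i ∈ Finset.range (m + 1), ∑ j ∈ Finset.range (n + (m - i) + 1),
      (a (m - i) j : ℂ) *
        (x.2 ^ i * x.1 ^ (j - n) * y.1 ^ (m - i - (j - n)) * y.2 ^ (n - j)))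
    (by fun_prop) (by
      rintro ⟨p, q⟩ ⟨-, hp, hq, hqi, hpq⟩ h
      refine homogenization_ne_zero m (fun k => (a k (n + k) : ℂ)) (by exact_mod_cast hlead) hQ
        hp hq hqi hpq ?_
      rw [← h]
      refine Finset.sum_congr rfl fun i _ => ?_
      rw [Finset.sum_eq_single (n + (m - i))]
      · simp
      · intro j hj hne
        have : j < n + (m - i) := by grind
        rcases lt_or_ge j n with hjn | hjn
        · simp [zero_pow (show n - j ≠ 0 by omega)]
        · simp [zero_pow (show m - i - (j - n) ≠ 0 by omega)]
      · simp)
  obtain ⟨ε, hε, hball⟩ := Metric.eventually_nhds_iff.1 hev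
  refine ⟨2 / ε, by positivity, fun α hα z hz hzR h => ?_⟩
  have hR : ε⁻¹ < 2 / ε := by
    rw [div_eq_mul_inv]
    linarith [inv_pos.2 hε]
  have hα0 : 0 < α := lt_of_lt_of_le (by positivity) hα
  have hz0 : 0 < ‖z‖ := lt_of_lt_of_le (by positivity) hzR
  have hzC : z ≠ 0 := norm_pos_iff.1 hz0
  set t : ℝ := (α + ‖z‖)⁻¹ with ht
  have ht0 : 0 < t := by positivity
  have hsum : ‖z * t‖ + ‖(α : ℂ) * t‖ = 1 := by
    rw [norm_mul, norm_mul, Complex.norm_real, Complex.norm_real, Real.norm_of_nonneg hα0.le,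
      Real.norm_of_nonneg ht0.le, ← add_mul, add_comm, ht, mul_inv_cancel₀ (by positivity)]
  have hsmall : dist ((t : ℂ), z⁻¹) 0 < ε := by
    rw [dist_zero_right, Prod.norm_mk, max_lt_iff, Complex.norm_real,
      Real.norm_of_nonneg ht0.le, norm_inv, ht, inv_lt_comm₀ (by positivity) hε,
      inv_lt_comm₀ hz0 hε]
    constructor <;> linarith
  refine hball hsmall (z * t, α * t) ⟨?_, ?_, ?_, ?_, hsum⟩ ?_
  · rw [mem_closedBall_zero_iff, Prod.norm_mk, max_le_iff]
    constructor <;> linarith [norm_nonneg (z * t), norm_nonneg ((α : ℂ) * t)]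
  · simpa using mul_nonneg hz ht0.le
  · simpa using mul_nonneg hα0.le ht0.le
  · simp
  · have hzn : z ^ n ≠ 0 := pow_ne_zero _ hzC
    rw [← mul_right_inj' hzn, mul_zero, ← mul_zero ((t : ℂ) ^ m), ← h, Finset.mul_sum,
      Finset.mul_sum]
    refine Finset.sum_congr rfl fun i hi => ?_
    obtain ⟨k, rfl⟩ := Nat.exists_eq_add_of_le (Nat.lt_succ_iff.1 (Finset.mem_range.1 hi))
    rw [Nat.add_sub_cancel_left, Finset.mul_sum, Finset.mul_sum, Finset.mul_sum]
    refine Finset.sum_congr rfl fun j hj => ?_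
    rcases le_total n j with hjn | hjn
    · obtain ⟨d, rfl⟩ := Nat.exists_eq_add_of_le hjn
      obtain ⟨e, rfl⟩ := Nat.exists_eq_add_of_le (show d ≤ k by grind)
      simp only [Nat.add_sub_cancel_left, Nat.sub_eq_zero_of_le hjn, pow_zero]
      ring
    · obtain ⟨d, rfl⟩ := Nat.exists_eq_add_of_le hjn
      simp only [Nat.add_sub_cancel_left, Nat.sub_eq_zero_of_le hjn, pow_zero, Nat.sub_zero]
      have hd : z ^ d * z⁻¹ ^ d = 1 := by rw [← mul_pow, mul_inv_cancel₀ hzC, one_pow]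
      linear_combination ((a k j : ℂ) * z ^ j * α ^ i * t ^ (i + k)) * hd

/-- Theorem 4.5 (Hurwitz part): if all complex roots of `P₀` and of `Q` have
strictly negative real part, then for all sufficiently large gains `α` every
complex root of `P_α(s) = Σ_{i=0}^m α^i P_{m−i}(s)` has strictly negative real
part. Here `P_i(s) = Σ_{j=0}^{n+i} a_{i,j} s^j` are real polynomials of exact
degree `n+i` with `P_m` monic, and `Q(s) = Σ_{i=0}^m a_{m−i,n+m−i} s^{m−i}`. -/
theorem roots_in_LHP_for_large_alpha
    (n m : ℕ) (hn : 1 ≤ n) (hm : 1 ≤ m)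
    (a : ℕ → ℕ → ℝ)
    (hlead : ∀ i ≤ m, a i (n + i) ≠ 0)
    (hmonic : a m (n + m) = 1)
    (hP0 : ∀ z : ℂ,
      (∑ j ∈ Finset.range (n + 1), (a 0 j : ℂ) * z ^ j) = 0 → z.re < 0)
    (hQ : ∀ z : ℂ,
      (∑ i ∈ Finset.range (m + 1), (a (m - i) (n + (m - i)) : ℂ) * z ^ (m - i)) = 0 →
      z.re < 0) :
    ∃ ᾱ : ℝ, 0 ≤ ᾱ ∧ ∀ α : ℝ, ᾱ ≤ α → ∀ z : ℂ,
      (∑ i ∈ Finset.range (m + 1), (α : ℂ) ^ i *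
        ∑ j ∈ Finset.range (n + (m - i) + 1), (a (m - i) j : ℂ) * z ^ j) = 0 →
      z.re < 0 := by
  obtain ⟨R, hR, hlarge⟩ :=
    exists_forall_le_ne_zero_of_le_norm n m a (hlead m le_rfl) hQ
  obtain ⟨A, -, hbounded⟩ := exists_forall_le_ne_zero_of_norm_le n m a hP0 R
  refine ⟨max R A, hR.le.trans (le_max_left _ _), fun α hα z h => ?_⟩
  by_contra! hz
  rcases le_total ‖z‖ R with hzR | hzR
  · exact hbounded α ((le_max_right _ _).trans hα) z hz hzR h
  · exact hlarge α ((le_max_left _ _).trans hα) z hz hzR h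
end
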